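/- Let ξ ∈ F_ψ(Ω) and p ≥ 1. Then ‖ξ‖_ψ ≤ (ψ(p)/ψ(1)) · sup_{u≥p} (E|ξ|^u)^{1/u}/ψ(u). -/

import Mathlib

open MeasureTheory Real Filter

noncomputable def Fnorm {Ω : Type*} [MeasurableSpace Ω] (μ : Measure Ω)
    (ψ : ℝ → ℝ) (ξ : Ω → ℝ) : ℝ :=
  ⨆ u : {u : ℝ // 1 ≤ u}, (∫ ω, |ξ ω| ^ u.1 ∂μ) ^ (1 / u.1) / ψ u.1

/-- Membership in the space `F_ψ(Ω)`: all moments of order `u ≥ 1` are finite and the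
defining supremum is finite (bounded above). -/
def MemF {Ω : Type*} [MeasurableSpace Ω] (μ : Measure Ω) (ψ : ℝ → ℝ) (ξ : Ω → ℝ) : Prop :=
  (∀ u : ℝ, 1 ≤ u → Integrable (fun ω => |ξ ω| ^ u) μ) ∧
    BddAbove (Set.range fun u : {u : ℝ // 1 ≤ u} =>
      (∫ ω, |ξ ω| ^ u.1 ∂μ) ^ (1 / u.1) / ψ u.1)

theorem stmt15 {Ω : Type*} [MeasurableSpace Ω] (μ : Measure Ω) [IsProbabilityMeasure μ]
    (ψ : ℝ → ℝ) (hψpos : ∀ u : ℝ, 1 ≤ u → 0 < ψ u)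
    (hψmono : StrictMonoOn ψ (Set.Ici 1)) (hψcont : ContinuousOn ψ (Set.Ici 1))
    (hψtop : Tendsto ψ atTop atTop)
    (p : ℝ) (hp : 1 ≤ p)
    (ξ : Ω → ℝ) (hmem : MemF μ ψ ξ) :
    Fnorm μ ψ ξ ≤
      ψ p / ψ 1 * ⨆ u : {u : ℝ // p ≤ u}, (∫ ω, |ξ ω| ^ u.1 ∂μ) ^ (1 / u.1) / ψ u.1 := by
  obtain ⟨hint, B, hB⟩ := hmem
  have hm0 : ∀ u : ℝ, 0 ≤ ∫ ω, |ξ ω| ^ u ∂μ := fun u =>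
    integral_nonneg fun ω => Real.rpow_nonneg (abs_nonneg _) _
  have hbdd : BddAbove (Set.range fun u : {u : ℝ // p ≤ u} =>
      (∫ ω, |ξ ω| ^ u.1 ∂μ) ^ (1 / u.1) / ψ u.1) := by
    refine ⟨B, ?_⟩
    rintro _ ⟨u, rfl⟩
    exact hB ⟨⟨u.1, hp.trans u.2⟩, rfl⟩
  have hle := le_ciSup hbdd
  set S := ⨆ u : {u : ℝ // p ≤ u}, (∫ ω, |ξ ω| ^ u.1 ∂μ) ^ (1 / u.1) / ψ u.1 with hS
  have h1 : 0 < ψ 1 := hψpos 1 le_rfl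
  have hpp : 0 < ψ p := hψpos p hp
  have h1p : ψ 1 ≤ ψ p := hψmono.monotoneOn (Set.mem_Ici.2 le_rfl) (Set.mem_Ici.2 hp) hp
  have hSp : (∫ ω, |ξ ω| ^ p ∂μ) ^ (1 / p) / ψ p ≤ S := hle ⟨p, le_rfl⟩
  have hS0 : 0 ≤ S := le_trans (div_nonneg (Real.rpow_nonneg (hm0 p) _) hpp.le) hSp
  unfold Fnorm
  haveI : Nonempty {u : ℝ // 1 ≤ u} := ⟨⟨1, le_rfl⟩⟩
  refine ciSup_le ?_
  rintro ⟨u, hu⟩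
  show (∫ ω, |ξ ω| ^ u ∂μ) ^ (1 / u) / ψ u ≤ ψ p / ψ 1 * S
  have hu0 : 0 < u := by linarith
  have hp0 : 0 < p := by linarith
  rcases le_total p u with hpu | hup
  · refine (hle ⟨u, hpu⟩).trans ?_
    exact le_mul_of_one_le_left hS0 ((one_le_div h1).2 h1p)
  · have h1u : ψ 1 ≤ ψ u := hψmono.monotoneOn (Set.mem_Ici.2 le_rfl) (Set.mem_Ici.2 hu) hu
    have hq : 1 ≤ p / u := (one_le_div hu0).2 hup
    have heq : ∀ ω, (|ξ ω| ^ u) ^ (p / u) = |ξ ω| ^ p := fun ω => by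
      rw [← Real.rpow_mul (abs_nonneg _), mul_div_cancel₀ _ hu0.ne']
    have hJ : (∫ ω, |ξ ω| ^ u ∂μ) ^ (p / u) ≤ ∫ ω, |ξ ω| ^ p ∂μ := by
      have := (convexOn_rpow hq).map_integral_le (μ := μ) (f := fun ω => |ξ ω| ^ u)
        (Real.continuous_rpow_const (by linarith)).continuousOn isClosed_Ici
        (Eventually.of_forall fun ω => Set.mem_Ici.2 (Real.rpow_nonneg (abs_nonneg _) _))
        (hint u hu) (by simpa only [Function.comp_def, heq] using hint p hp)
      simpa only [heq] using this
    have hL : (∫ ω, |ξ ω| ^ u ∂μ) ^ (1 / u) ≤ (∫ ω, |ξ ω| ^ p ∂μ) ^ (1 / p) := by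
      have h := Real.rpow_le_rpow (Real.rpow_nonneg (hm0 u) _) hJ (by positivity : 0 ≤ 1 / p)
      rw [← Real.rpow_mul (hm0 u)] at h
      have e : p / u * (1 / p) = 1 / u := by field_simp
      rwa [e] at h
    calc (∫ ω, |ξ ω| ^ u ∂μ) ^ (1 / u) / ψ u
        ≤ (∫ ω, |ξ ω| ^ p ∂μ) ^ (1 / p) / ψ 1 :=
          div_le_div₀ (Real.rpow_nonneg (hm0 p) _) hL h1 h1u
      _ = ψ p / ψ 1 * ((∫ ω, |ξ ω| ^ p ∂μ) ^ (1 / p) / ψ p) := by field_simp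
      _ ≤ ψ p / ψ 1 * S := mul_le_mul_of_nonneg_left hSp (by positivity)
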